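/- Let Λ be a finitely aligned k-graph, let E ⊆ Λ be finite, and let {t_λ : λ ∈ Λ} be a collection of elements of a C*-algebra satisfying (TCK1), (TCK2) and (TCK3). Then for every (λ,μ) ∈ ΠE ×_{d,s} ΠE, t_λ t_μ* = Σ_{ν : λν ∈ ΠE} Θ(t)^{ΠE}_{λν,μν}, where the sum is over all ν ∈ s(λ)Λ (including ν = s(λ)) with λν ∈ ΠE. -/

import Mathlib

open scoped ENNReal

attribute [local instance] Classical.propDecidable

/-- Product of `f` over a set `S`, in some arbitrary order (junk value `1` if `S` is
infinite).  Used for products of commuting projections. -/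
noncomputable def listProd {ι A : Type*} [Monoid A] (S : Set ι) (f : ι → A) : A :=
  if h : S.Finite then (h.toFinset.toList.map f).prod else 1

/-- A `k`-graph: a countable category `Λ` (whose morphisms are the terms of `Path`, with
vertices identified with the morphisms of degree `0`) together with a degree functor
`d : Λ → ℕ^k` satisfying the factorisation property. -/
structure KGraph (k : ℕ) where
  Path : Type
  countable : Countable Path
  d : Path → Fin k → ℕ
  r : Path → Path
  s : Path → Path
  comp : Path → Path → Path
  d_r : ∀ lam, d (r lam) = 0
  d_s : ∀ lam, d (s lam) = 0
  r_r : ∀ lam, r (r lam) = r lam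
  s_r : ∀ lam, s (r lam) = r lam
  r_s : ∀ lam, r (s lam) = s lam
  s_s : ∀ lam, s (s lam) = s lam
  comp_source : ∀ lam, comp lam (s lam) = lam
  range_comp : ∀ lam, comp (r lam) lam = lam
  r_comp : ∀ lam mu, s lam = r mu → r (comp lam mu) = r lam
  s_comp : ∀ lam mu, s lam = r mu → s (comp lam mu) = s mu
  d_comp : ∀ lam mu, s lam = r mu → d (comp lam mu) = d lam + d mu
  comp_assoc : ∀ lam mu nu, s lam = r mu → s mu = r nu →
    comp (comp lam mu) nu = comp lam (comp mu nu)
  factor : ∀ lam m n, d lam = m + n →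
    ∃! p : Path × Path, s p.1 = r p.2 ∧ d p.1 = m ∧ d p.2 = n ∧ comp p.1 p.2 = lam

namespace KGraph

variable {k : ℕ} (Λ : KGraph k)

/-- Vertices are identified with the paths of degree `0`. -/
def IsVertex (v : Λ.Path) : Prop := Λ.d v = 0

/-- The unique factorisation of `lam` as a product of a path of degree `m` and the
remaining tail (junk value if `¬ m ≤ d lam`). -/
noncomputable def split (lam : Λ.Path) (m : Fin k → ℕ) : Λ.Path × Λ.Path :=
  if h : m ≤ Λ.d lam then
    (Λ.factor lam m (Λ.d lam - m) (by
      funext i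
      exact (Nat.add_sub_cancel' (h i)).symm)).choose
  else (lam, lam)

/-- The segment `λ(m,n)` of the path `λ`: the unique path of degree `n - m` such that
`λ = λ(0,m) λ(m,n) λ(n, d λ)` (meaningful for `m ≤ n ≤ d λ`). -/
noncomputable def seg (lam : Λ.Path) (m n : Fin k → ℕ) : Λ.Path :=
  (Λ.split (Λ.split lam n).1 m).2

/-- `MCE(μ,ν)`: minimal common extensions of `μ` and `ν`. -/
def MCE (mu nu : Λ.Path) : Set Λ.Path :=
  {lam | Λ.d lam = Λ.d mu ⊔ Λ.d nu ∧ Λ.seg lam 0 (Λ.d mu) = mu ∧ Λ.seg lam 0 (Λ.d nu) = nu}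

/-- `Λ^min(μ,ν) = {(α,β) : μα = νβ ∈ MCE(μ,ν)}`. -/
def Lmin (mu nu : Λ.Path) : Set (Λ.Path × Λ.Path) :=
  {p | Λ.s mu = Λ.r p.1 ∧ Λ.s nu = Λ.r p.2 ∧ Λ.comp mu p.1 = Λ.comp nu p.2 ∧
    Λ.comp mu p.1 ∈ Λ.MCE mu nu}

/-- `Ext(μ;E)`: extensions of `μ` with respect to `E`. -/
def Ext (mu : Λ.Path) (E : Set Λ.Path) : Set Λ.Path :=
  {a | Λ.r a = Λ.s mu ∧ ∃ nu ∈ E, ∃ b, (a, b) ∈ Λ.Lmin mu nu}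

/-- `Λ` is finitely aligned if all the sets `MCE(μ,ν)` are finite. -/
def FinitelyAligned : Prop := ∀ mu nu, (Λ.MCE mu nu).Finite

/-- `E ⊆ vΛ` is exhaustive if `Ext(λ;E) ≠ ∅` for all `λ ∈ vΛ`. -/
def Exhaustive (v : Λ.Path) (E : Set Λ.Path) : Prop :=
  ∀ lam, Λ.r lam = v → (Λ.Ext lam E).Nonempty

/-- `E ∈ vFE(Λ)`: `E ⊆ vΛ \ {v}` is finite and exhaustive (so `r(E) = v`). -/
def FEat (v : Λ.Path) (E : Set Λ.Path) : Prop :=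
  Λ.IsVertex v ∧ (∀ lam ∈ E, Λ.r lam = v ∧ lam ≠ v) ∧ E.Finite ∧ Λ.Exhaustive v E

/-- `FE(Λ)`: the finite exhaustive sets. -/
def FE : Set (Set Λ.Path) := {E | ∃ v, Λ.FEat v E}

/-- `λE = {λμ : μ ∈ E, r(μ) = s(λ)}`. -/
def lamSet (lam : Λ.Path) (E : Set Λ.Path) : Set Λ.Path :=
  {x | ∃ mu ∈ E, Λ.s lam = Λ.r mu ∧ Λ.comp lam mu = x}

/-- `EΛ = {λμ : λ ∈ E, r(μ) = s(λ)}`. -/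
def setLam (E : Set Λ.Path) : Set Λ.Path :=
  {x | ∃ lam ∈ E, ∃ mu, Λ.s lam = Λ.r mu ∧ Λ.comp lam mu = x}

/-- `𝓔 ⊆ FE(Λ)` is satiated if it satisfies (S1)--(S4). -/
def Satiated (𝓔 : Set (Set Λ.Path)) : Prop :=
  𝓔 ⊆ Λ.FE ∧
  (∀ G ∈ 𝓔, ∀ E ∈ Λ.FE, G ⊆ E → E ∈ 𝓔) ∧
  (∀ G ∈ 𝓔, ∀ v, Λ.FEat v G → ∀ mu, Λ.r mu = v → mu ∉ Λ.setLam G → Λ.Ext mu G ∈ 𝓔) ∧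
  (∀ G ∈ 𝓔, ∀ n : Λ.Path → Fin k → ℕ, (∀ lam ∈ G, 0 < n lam ∧ n lam ≤ Λ.d lam) →
    ((fun lam => Λ.seg lam 0 (n lam)) '' G) ∈ 𝓔) ∧
  (∀ G ∈ 𝓔, ∀ G' ⊆ G, ∀ Gl : Λ.Path → Set Λ.Path,
    (∀ lam ∈ G', Gl lam ∈ 𝓔 ∧ Λ.FEat (Λ.s lam) (Gl lam)) →
    ((G \ G') ∪ ⋃ lam ∈ G', Λ.lamSet lam (Gl lam)) ∈ 𝓔)

/-- The satiation `𝓔̄` of `𝓔`: the smallest satiated subset of `FE(Λ)` containing `𝓔`. -/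
def satiation (𝓔 : Set (Set Λ.Path)) : Set (Set Λ.Path) :=
  ⋂₀ {F | 𝓔 ⊆ F ∧ Λ.Satiated F}

/-- `ΠE`: the smallest subset of `Λ` containing `E` which is closed under the operation
`(λ,μ,σ) ↦ λ Ext(μ;{σ})` for `λ,μ,σ ∈ ΠE` with `d(λ) = d(μ)`, `s(λ) = s(μ)`. -/
def PiSet (E : Set Λ.Path) : Set Λ.Path :=
  ⋂₀ {G | E ⊆ G ∧ ∀ lam mu sig, lam ∈ G → mu ∈ G → sig ∈ G →
    Λ.d lam = Λ.d mu → Λ.s lam = Λ.s mu → Λ.lamSet lam (Λ.Ext mu {sig}) ⊆ G}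

/-- `Σ₁(𝓔)`: finite sets `F ⊆ r(E)Λ \ Λ⁰` containing some `E ∈ 𝓔`. -/
def Sig1 (𝓔 : Set (Set Λ.Path)) : Set (Set Λ.Path) :=
  {F | ∃ E ∈ 𝓔, ∃ v, Λ.FEat v E ∧ E ⊆ F ∧ F.Finite ∧
    ∀ lam ∈ F, Λ.r lam = v ∧ ¬ Λ.IsVertex lam}

/-- `Σ₂(𝓔) = {Ext(μ;E) : E ∈ 𝓔, μ ∈ r(E)Λ \ EΛ}`. -/
def Sig2 (𝓔 : Set (Set Λ.Path)) : Set (Set Λ.Path) :=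
  {F | ∃ E ∈ 𝓔, ∃ v, Λ.FEat v E ∧ ∃ mu, Λ.r mu = v ∧ mu ∉ Λ.setLam E ∧ F = Λ.Ext mu E}

/-- `Σ₃(𝓔) = {{λ(0,n_λ) : λ ∈ E} : E ∈ 𝓔, 0 < n_λ ≤ d(λ)}`. -/
def Sig3 (𝓔 : Set (Set Λ.Path)) : Set (Set Λ.Path) :=
  {F | ∃ E ∈ 𝓔, ∃ n : Λ.Path → Fin k → ℕ, (∀ lam ∈ E, 0 < n lam ∧ n lam ≤ Λ.d lam) ∧
    F = (fun lam => Λ.seg lam 0 (n lam)) '' E}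

/-- `Σ₄(𝓔) = {(E \ F) ∪ ⋃_{λ ∈ F} λ F_λ : E ∈ 𝓔, F ⊆ E, F_λ ∈ s(λ)𝓔}`. -/
def Sig4 (𝓔 : Set (Set Λ.Path)) : Set (Set Λ.Path) :=
  {G | ∃ E ∈ 𝓔, ∃ F ⊆ E, ∃ Fl : Λ.Path → Set Λ.Path,
    (∀ lam ∈ F, Fl lam ∈ 𝓔 ∧ Λ.FEat (Λ.s lam) (Fl lam)) ∧
    G = (E \ F) ∪ ⋃ lam ∈ F, Λ.lamSet lam (Fl lam)}

/-- `Σ = Σ₄ ∘ Σ₃ ∘ Σ₂ ∘ Σ₁`. -/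
def SigmaStep (𝓔 : Set (Set Λ.Path)) : Set (Set Λ.Path) :=
  Λ.Sig4 (Λ.Sig3 (Λ.Sig2 (Λ.Sig1 𝓔)))

/-- `Σ^∞(𝓔) = ⋃_{n ≥ 1} Σ^n(𝓔)`. -/
def SigmaInf (𝓔 : Set (Set Λ.Path)) : Set (Set Λ.Path) :=
  ⋃ n : ℕ, (Λ.SigmaStep)^[n + 1] 𝓔

section StarAlgebra

variable {A : Type*} [Ring A] [StarRing A]

/-- The product `∏_{λ ∈ E} (t_v - t_λ t_λ*)` (the factors pairwise commute for any
family satisfying (TCK1)--(TCK3), so the implicit choice of ordering is immaterial). -/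
noncomputable def gapProd (t : Λ.Path → A) (v : Λ.Path) (E : Set Λ.Path) : A :=
  listProd E fun lam => t v - t lam * star (t lam)

/-- Conditions (TCK1)--(TCK3) on a family `{t_λ}`. -/
def TCKFamily (t : Λ.Path → A) : Prop :=
  (∀ v, Λ.IsVertex v → star (t v) = t v ∧ t v * t v = t v) ∧
  (∀ v w, Λ.IsVertex v → Λ.IsVertex w → v ≠ w → t v * t w = 0) ∧
  (∀ lam mu, Λ.s lam = Λ.r mu → t lam * t mu = t (Λ.comp lam mu)) ∧
  (∀ lam mu, star (t lam) * t mu = ∑ᶠ p ∈ Λ.Lmin lam mu, t p.1 * star (t p.2))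

/-- A relative Cuntz-Krieger `(Λ;𝓔)`-family: (TCK1)--(TCK3) together with (CK). -/
def RCKFamily (𝓔 : Set (Set Λ.Path)) (t : Λ.Path → A) : Prop :=
  Λ.TCKFamily t ∧ ∀ E ∈ 𝓔, ∀ v, Λ.FEat v E → Λ.gapProd t v E = 0

/-- `Θ(t)^{ΠE}_{λ,μ} = t_λ (∏_{λν ∈ ΠE, d(ν) > 0} (t_{s(λ)} - t_ν t_ν*)) t_μ*`. -/
noncomputable def Theta (t : Λ.Path → A) (E : Set Λ.Path) (lam mu : Λ.Path) : A :=
  t lam *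
    listProd {nu | Λ.s lam = Λ.r nu ∧ ¬ Λ.IsVertex nu ∧ Λ.comp lam nu ∈ Λ.PiSet E}
      (fun nu => t (Λ.s lam) - t nu * star (t nu)) *
    star (t mu)

end StarAlgebra

end KGraph

/-- A graph morphism `x : Ω_{k,m} → Λ`, encoded by its length `m = d(x) ∈ (ℕ∪{∞})^k`
and its values `x(p,q)` on the morphisms `(p,q)` of `Ω_{k,m}` (with the junk value
`x(0,0)` outside the meaningful domain, so graph morphisms are extensional). -/
structure GMor {k : ℕ} (Λ : KGraph k) where
  len : Fin k → ℕ∞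
  seg : (Fin k → ℕ) → (Fin k → ℕ) → Λ.Path
  d_seg : ∀ p q, p ≤ q → (∀ i, (q i : ℕ∞) ≤ len i) → Λ.d (seg p q) = q - p
  r_seg : ∀ p q, p ≤ q → (∀ i, (q i : ℕ∞) ≤ len i) → Λ.r (seg p q) = seg p p
  s_seg : ∀ p q, p ≤ q → (∀ i, (q i : ℕ∞) ≤ len i) → Λ.s (seg p q) = seg q q
  comp_seg : ∀ p q u, p ≤ q → q ≤ u → (∀ i, (u i : ℕ∞) ≤ len i) →
    Λ.comp (seg p q) (seg q u) = seg p u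
  seg_junk : ∀ p q, ¬ (p ≤ q ∧ ∀ i, (q i : ℕ∞) ≤ len i) → seg p q = seg 0 0

namespace GMor

variable {k : ℕ} {Λ : KGraph k}

/-- The range `r(x) = x(0)` of a graph morphism. -/
def range (x : GMor Λ) : Λ.Path := x.seg 0 0

/-- `y = x|_n^{d(x)}`, the restriction of `x` (defined for `n ≤ d(x)`):
`d(y) = d(x) - n` and `y(p,q) = x(n+p, n+q)`. -/
def IsRestriction (y x : GMor Λ) (n : Fin k → ℕ) : Prop :=
  (∀ i, y.len i = x.len i - (n i : ℕ∞)) ∧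
  ∀ p q, p ≤ q → (∀ i, (q i : ℕ∞) ≤ y.len i) → y.seg p q = x.seg (n + p) (n + q)

/-- `y = λx`, the extension of `x` by `λ ∈ Λ r(x)`: `d(y) = d(λ) + d(x)`,
`y(0, d(λ)) = λ` and `y(d(λ), d(λ)+n) = x(0,n)` for `n ≤ d(x)`. -/
def IsExtension (y : GMor Λ) (lam : Λ.Path) (x : GMor Λ) : Prop :=
  (∀ i, y.len i = (Λ.d lam i : ℕ∞) + x.len i) ∧
  y.seg 0 (Λ.d lam) = lam ∧
  ∀ n : Fin k → ℕ, (∀ i, (n i : ℕ∞) ≤ x.len i) →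
    y.seg (Λ.d lam) (Λ.d lam + n) = x.seg 0 n

/-- `x ∈ FΛ^∞`: `x` has an initial segment belonging to `F`. -/
def HasInit (x : GMor Λ) (F : Set Λ.Path) : Prop :=
  ∃ lam ∈ F, (∀ i, (Λ.d lam i : ℕ∞) ≤ x.len i) ∧ x.seg 0 (Λ.d lam) = lam

/-- `z` restricts to `x` on `Ω_{k, d(x)}`. -/
def Agrees (z x : GMor Λ) : Prop :=
  ∀ p q, p ≤ q → (∀ i, (q i : ℕ∞) ≤ x.len i) → z.seg p q = x.seg p q

/-- `z ∈ MCE(x,y)` for graph morphisms `x, y`. -/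
def IsMCE (z x y : GMor Λ) : Prop :=
  (∀ i, z.len i = max (x.len i) (y.len i)) ∧ z.Agrees x ∧ z.Agrees y

/-- `x` is aperiodic: for distinct `λ, μ ∈ Λ r(x)`, `MCE(λx, μx) = ∅`. -/
def Aperiodic (x : GMor Λ) : Prop :=
  ∀ lam mu : Λ.Path, lam ≠ mu → Λ.s lam = x.range → Λ.s mu = x.range →
    ∀ lx mx : GMor Λ, lx.IsExtension lam x → mx.IsExtension mu x →
      ∀ z : GMor Λ, ¬ z.IsMCE lx mx

end GMor

namespace KGraph

variable {k : ℕ} (Λ : KGraph k)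

/-- `x ∈ ∂(Λ;𝓔)`: an `𝓔`-compatible boundary path. -/
def IsBdry (𝓔 : Set (Set Λ.Path)) (x : GMor Λ) : Prop :=
  ∀ n : Fin k → ℕ, (∀ i, (n i : ℕ∞) ≤ x.len i) →
    ∀ E ∈ 𝓔, Λ.FEat (x.seg n n) E →
      ∃ lam ∈ E, (∀ i, ((n + Λ.d lam) i : ℕ∞) ≤ x.len i) ∧ x.seg n (n + Λ.d lam) = lam

/-- Condition (C): aperiodic `𝓔`-compatible boundary paths out of every vertex, and
avoiding any given `F ∈ vFE(Λ) \ 𝓔`. -/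
def CondC (𝓔 : Set (Set Λ.Path)) : Prop :=
  (∀ v, Λ.IsVertex v → ∃ x : GMor Λ, Λ.IsBdry 𝓔 x ∧ x.range = v ∧ x.Aperiodic) ∧
  (∀ v F, Λ.FEat v F → F ∉ 𝓔 →
    ∃ x : GMor Λ, Λ.IsBdry 𝓔 x ∧ x.range = v ∧ ¬ x.HasInit F ∧ x.Aperiodic)

end KGraph

namespace KGraph

variable {k : ℕ} (Λ : KGraph k)

section Paths

variable {Λ}

lemma comp_inj {a b a' b' : Λ.Path} (h : Λ.s a = Λ.r b) (h' : Λ.s a' = Λ.r b')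
    (hc : Λ.comp a b = Λ.comp a' b') (hd : Λ.d a = Λ.d a') : a = a' ∧ b = b' := by
  have e := Λ.d_comp a b h
  have e' := Λ.d_comp a' b' h'
  have hb : Λ.d b' = Λ.d b := by
    rw [hc, e', hd] at e
    exact add_left_cancel e
  have := (Λ.factor (Λ.comp a b) (Λ.d a) (Λ.d b) e).unique
    (y₁ := (a, b)) (y₂ := (a', b')) ⟨h, rfl, rfl, rfl⟩ ⟨h', hd.symm, hb, hc.symm⟩
  exact ⟨congrArg Prod.fst this, congrArg Prod.snd this⟩

lemma exists_comp_eq {x : Λ.Path} {m : Fin k → ℕ} (hm : m ≤ Λ.d x) :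
    ∃ a b, Λ.s a = Λ.r b ∧ Λ.d a = m ∧ Λ.comp a b = x := by
  obtain ⟨⟨a, b⟩, ⟨h1, h2, -, h4⟩, -⟩ := Λ.factor x m (Λ.d x - m) (add_tsub_cancel_of_le hm).symm
  exact ⟨a, b, h1, h2, h4⟩

lemma r_eq_self {x : Λ.Path} (hx : Λ.d x = 0) : Λ.r x = x :=
  (comp_inj (Λ.s_r x) (Λ.r_s x).symm ((Λ.range_comp x).trans (Λ.comp_source x).symm)
    ((Λ.d_r x).trans hx.symm)).1

lemma comp_vertex {x v : Λ.Path} (h : Λ.s x = Λ.r v) (hv : Λ.d v = 0) : Λ.comp x v = x := by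
  rw [r_eq_self hv] at h
  rw [← h, Λ.comp_source]

lemma split_fst_eq {a b : Λ.Path} (h : Λ.s a = Λ.r b) :
    (Λ.split (Λ.comp a b) (Λ.d a)).1 = a ∧ (Λ.split (Λ.comp a b) (Λ.d a)).2 = b := by
  have hle : Λ.d a ≤ Λ.d (Λ.comp a b) := by rw [Λ.d_comp a b h]; exact le_self_add
  have e : Λ.d (Λ.comp a b) = Λ.d a + (Λ.d (Λ.comp a b) - Λ.d a) :=
    (add_tsub_cancel_of_le hle).symm
  have hs := (Λ.factor _ _ _ e).choose_spec.1
  unfold split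
  rw [dif_pos hle]
  exact comp_inj hs.1 h hs.2.2.2 hs.2.1

lemma seg_zero_comp {a b : Λ.Path} (h : Λ.s a = Λ.r b) :
    Λ.seg (Λ.comp a b) 0 (Λ.d a) = a := by
  unfold seg
  rw [(split_fst_eq h).1]
  have := (split_fst_eq (Λ.s_r a)).2
  rwa [Λ.range_comp, Λ.d_r] at this

lemma seg_zero_eq_iff {x a : Λ.Path} (hle : Λ.d a ≤ Λ.d x) :
    Λ.seg x 0 (Λ.d a) = a ↔ ∃ b, Λ.s a = Λ.r b ∧ Λ.comp a b = x := by
  constructor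
  · intro h
    obtain ⟨c, b, h1, h2, rfl⟩ := exists_comp_eq hle
    rw [← h2, seg_zero_comp h1] at h
    subst h
    exact ⟨b, h1, rfl⟩
  · rintro ⟨b, h, rfl⟩
    exact seg_zero_comp h

lemma mem_MCE {mu nu x : Λ.Path} : x ∈ Λ.MCE mu nu ↔ Λ.d x = Λ.d mu ⊔ Λ.d nu ∧
    (∃ a, Λ.s mu = Λ.r a ∧ Λ.comp mu a = x) ∧ ∃ b, Λ.s nu = Λ.r b ∧ Λ.comp nu b = x := by
  refine and_congr_right fun hd => ?_
  rw [seg_zero_eq_iff (hd ▸ le_sup_left), seg_zero_eq_iff (hd ▸ le_sup_right)]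

lemma MCE_comm (mu nu : Λ.Path) : Λ.MCE mu nu = Λ.MCE nu mu := by
  ext x
  rw [mem_MCE, mem_MCE, sup_comm]
  tauto

lemma mem_Lmin {mu nu a b : Λ.Path} : (a, b) ∈ Λ.Lmin mu nu ↔ Λ.s mu = Λ.r a ∧
    Λ.s nu = Λ.r b ∧ Λ.comp mu a = Λ.comp nu b ∧ Λ.d (Λ.comp mu a) = Λ.d mu ⊔ Λ.d nu := by
  refine and_congr_right fun h1 => and_congr_right fun h2 => and_congr_right fun h3 => ?_
  rw [mem_MCE]
  exact ⟨And.left, fun h => ⟨h, ⟨a, h1, rfl⟩, b, h2, h3.symm⟩⟩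

lemma mem_Lmin_symm {mu nu a b : Λ.Path} (h : (a, b) ∈ Λ.Lmin mu nu) :
    (b, a) ∈ Λ.Lmin nu mu := by
  rw [mem_Lmin] at h ⊢
  obtain ⟨h1, h2, h3, h4⟩ := h
  exact ⟨h2, h1, h3.symm, by rw [← h3, h4, sup_comm]⟩

lemma bijOn_Lmin (mu nu : Λ.Path) :
    Set.BijOn (fun p : Λ.Path × Λ.Path => Λ.comp mu p.1) (Λ.Lmin mu nu) (Λ.MCE mu nu) := by
  refine ⟨fun p hp => hp.2.2.2, ?_, ?_⟩
  · rintro ⟨a, b⟩ h ⟨a', b'⟩ h' (e : Λ.comp mu a = Λ.comp mu a')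
    rw [mem_Lmin] at h h'
    have e1 := (comp_inj h.1 h'.1 e rfl).2
    have e2 := (comp_inj h.2.1 h'.2.1 (h.2.2.1.symm.trans (e.trans h'.2.2.1)) rfl).2
    rw [e1, e2]
  · intro x hx
    obtain ⟨hd, ⟨a, h1, rfl⟩, b, h2, h3⟩ := mem_MCE.1 hx
    exact ⟨(a, b), mem_Lmin.2 ⟨h1, h2, h3.symm, hd⟩, rfl⟩

lemma exists_Lmin_of_comp_eq {mu nu a b : Λ.Path} (h1 : Λ.s mu = Λ.r a) (h2 : Λ.s nu = Λ.r b)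
    (h : Λ.comp mu a = Λ.comp nu b) :
    ∃ a' b' c, (a', b') ∈ Λ.Lmin mu nu ∧ Λ.s a' = Λ.r c ∧ Λ.s b' = Λ.r c ∧
      Λ.comp a' c = a ∧ Λ.comp b' c = b := by
  have l1 : Λ.d mu ≤ Λ.d (Λ.comp mu a) := by rw [Λ.d_comp _ _ h1]; exact le_self_add
  have l2 : Λ.d nu ≤ Λ.d (Λ.comp mu a) := by rw [h, Λ.d_comp _ _ h2]; exact le_self_add
  obtain ⟨x, c, hxc, hdx, hx⟩ := exists_comp_eq (sup_le l1 l2)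
  obtain ⟨m', a', hma, hdm, hm⟩ := exists_comp_eq (x := x) (hdx ▸ le_sup_left : Λ.d mu ≤ Λ.d x)
  obtain ⟨n', b', hnb, hdn, hn⟩ := exists_comp_eq (x := x) (hdx ▸ le_sup_right : Λ.d nu ≤ Λ.d x)
  have hac : Λ.s a' = Λ.r c := by rw [← hxc, ← hm, Λ.s_comp _ _ hma]
  have hbc : Λ.s b' = Λ.r c := by rw [← hxc, ← hn, Λ.s_comp _ _ hnb]
  have ea := comp_inj (a := m') (b := Λ.comp a' c) (by rw [Λ.r_comp _ _ hac, hma]) h1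
    (by rw [← Λ.comp_assoc _ _ _ hma hac, hm, hx]) hdm
  have eb := comp_inj (a := n') (b := Λ.comp b' c) (by rw [Λ.r_comp _ _ hbc, hnb]) h2
    (by rw [← Λ.comp_assoc _ _ _ hnb hbc, hn, hx, h]) hdn
  obtain ⟨rfl, ea⟩ := ea
  obtain ⟨rfl, eb⟩ := eb
  exact ⟨a', b', c, mem_Lmin.2 ⟨hma, hnb, hm.trans hn.symm, by rw [hm, hdx]⟩, hac, hbc, ea, eb⟩

end Paths

section PiSet

variable {Λ} {E : Set Λ.Path}

lemma subset_PiSet : E ⊆ Λ.PiSet E := fun _ hx _ hG => hG.1 hx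

lemma comp_mem_PiSet {lam mu sig a b : Λ.Path} (hl : lam ∈ Λ.PiSet E) (hm : mu ∈ Λ.PiSet E)
    (hsig : sig ∈ Λ.PiSet E) (hd : Λ.d lam = Λ.d mu) (hs : Λ.s lam = Λ.s mu)
    (hab : (a, b) ∈ Λ.Lmin mu sig) : Λ.comp lam a ∈ Λ.PiSet E := by
  intro G hG
  have ha := hab.1
  exact hG.2 lam mu sig (hl G hG) (hm G hG) (hsig G hG) hd hs
    ⟨a, ⟨ha.symm, sig, rfl, b, hab⟩, hs.trans ha, rfl⟩

lemma PiSet_induction {P : Λ.Path → Prop} (hE : ∀ x ∈ E, P x)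
    (hstep : ∀ lam mu sig a b, lam ∈ Λ.PiSet E → mu ∈ Λ.PiSet E → sig ∈ Λ.PiSet E →
      P lam → P mu → P sig → Λ.d lam = Λ.d mu → Λ.s lam = Λ.s mu → (a, b) ∈ Λ.Lmin mu sig →
      P (Λ.comp lam a)) :
    ∀ x ∈ Λ.PiSet E, P x := by
  intro x hx
  refine (hx {y | y ∈ Λ.PiSet E ∧ P y} ⟨fun y hy => ⟨subset_PiSet hy, hE y hy⟩, ?_⟩).2
  rintro lam mu sig ⟨hl, pl⟩ ⟨hm, pm⟩ ⟨hsig, ps⟩ hd hs y ⟨a, ⟨-, sig', rfl, b, hab⟩, -, rfl⟩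
  exact ⟨comp_mem_PiSet hl hm hsig hd hs hab, hstep _ _ _ _ _ hl hm hsig pl pm ps hd hs hab⟩

lemma d_comp_of_mem_Lmin {lam mu sig a b : Λ.Path} (hd : Λ.d lam = Λ.d mu)
    (hs : Λ.s lam = Λ.s mu) (hab : (a, b) ∈ Λ.Lmin mu sig) :
    Λ.d (Λ.comp lam a) = Λ.d mu ⊔ Λ.d sig := by
  obtain ⟨h1, -, -, h4⟩ := mem_Lmin.1 hab
  rw [← h4, Λ.d_comp _ _ (hs.trans h1), Λ.d_comp _ _ h1, hd]

lemma exists_d_le_of_mem_PiSet (hE : E.Finite) : ∃ N, ∀ x ∈ Λ.PiSet E, Λ.d x ≤ N := by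
  obtain ⟨N, hN⟩ := (hE.image Λ.d).bddAbove
  refine ⟨N, PiSet_induction (fun x hx => hN ⟨x, hx, rfl⟩) ?_⟩
  intro lam mu sig a b _ _ _ _ pm ps hd hs hab
  rw [d_comp_of_mem_Lmin hd hs hab]
  exact sup_le pm ps

lemma finite_Lmin (hΛ : Λ.FinitelyAligned) (mu nu : Λ.Path) : (Λ.Lmin mu nu).Finite :=
  (bijOn_Lmin mu nu).finite_iff_finite.2 (hΛ mu nu)

/-- The set `E` together with all paths `λα` where `λ, μ, σ ∈ F` and `α ∈ Ext(μ;{σ})`. -/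
def basePaths (E F : Set Λ.Path) : Set Λ.Path :=
  E ∪ ⋃ lam ∈ F, ⋃ mu ∈ F, ⋃ sig ∈ F, (fun p => Λ.comp lam p.1) '' Λ.Lmin mu sig

/-- The paths obtained from a path in `B` by replacing an initial segment in `F` by another
path in `F` of the same degree. -/
def initialReplacements (F B : Set Λ.Path) : Set Λ.Path :=
  {x | ∃ lam ∈ F, ∃ mu ∈ F, ∃ a, Λ.d lam = Λ.d mu ∧ Λ.s lam = Λ.r a ∧ Λ.s mu = Λ.r a ∧
    Λ.comp mu a ∈ B ∧ Λ.comp lam a = x}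

lemma finite_basePaths (hΛ : Λ.FinitelyAligned) {F : Set Λ.Path} (hE : E.Finite)
    (hF : F.Finite) : (basePaths E F).Finite :=
  hE.union <| hF.biUnion fun _ _ => hF.biUnion fun _ _ => hF.biUnion fun _ _ =>
    (finite_Lmin hΛ _ _).image _

lemma finite_initialReplacements {F B : Set Λ.Path} (hF : F.Finite) (hB : B.Finite) :
    (initialReplacements F B).Finite := by
  refine ((hF.prod (hF.prod hB)).image fun p =>
    Λ.comp p.1 (Λ.split p.2.2 (Λ.d p.2.1)).2).subset ?_
  rintro x ⟨lam, hl, mu, hm, a, -, -, h2, hB, rfl⟩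
  exact ⟨(lam, mu, Λ.comp mu a), ⟨hl, hm, hB⟩, by simp only [(split_fst_eq h2).2]⟩

lemma PiSet_degree_subset (n : Fin k → ℕ) {F : Set Λ.Path}
    (hF : F = {x | x ∈ Λ.PiSet E ∧ Λ.d x < n}) :
    ∀ x ∈ Λ.PiSet E, Λ.d x = n → x ∈ basePaths E F ∪ initialReplacements F (basePaths E F) := by
  have memF : ∀ {x}, x ∈ Λ.PiSet E → Λ.d x < n → x ∈ F := fun h h' => hF ▸ ⟨h, h'⟩
  have base : ∀ {lam mu sig a b}, lam ∈ F → mu ∈ F → sig ∈ F → (a, b) ∈ Λ.Lmin mu sig →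
      Λ.comp lam a ∈ basePaths E F := by
    intro lam mu sig a b hl hm hsig hab
    refine Or.inr ?_
    simp only [Set.mem_iUnion]
    exact ⟨lam, hl, mu, hm, sig, hsig, (a, b), hab, rfl⟩
  refine PiSet_induction (fun x hx _ => Or.inl (Or.inl hx)) ?_
  intro lam mu sig a b hl hm hsig pl _ ps hd hs hab hn
  have hdeg := d_comp_of_mem_Lmin hd hs hab
  rw [hn] at hdeg
  obtain ⟨h1, h2, h3, h4⟩ := mem_Lmin.1 hab
  have hla := hs.trans h1
  rcases (hdeg ▸ le_sup_left : Λ.d mu ≤ n).lt_or_eq with hmn | hmn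
  swap
  · have ha : Λ.d a = 0 := by
      have := Λ.d_comp mu a h1
      rw [h4, ← hdeg, hmn] at this
      exact left_eq_add.1 this
    rw [comp_vertex hla ha]
    exact pl (hd.trans hmn)
  have hlF := memF hl (hd ▸ hmn)
  have hmF := memF hm hmn
  rcases (hdeg ▸ le_sup_right : Λ.d sig ≤ n).lt_or_eq with hsn | hsn
  · exact Or.inl (base hlF hmF (memF hsig hsn) hab)
  have hb : Λ.d b = 0 := by
    have := Λ.d_comp sig b h2
    rw [← h3, h4, ← hdeg, hsn] at this
    exact left_eq_add.1 this
  rw [comp_vertex h2 hb] at h3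
  rcases ps hsn with hB | ⟨lam', hl', mu', hm', a', hd', hla', hma', hB, hx⟩
  · exact Or.inr ⟨lam, hlF, mu, hmF, a, hd, hla, h1, h3.symm ▸ hB, rfl⟩
  have hl'' := hF ▸ hl'
  have hm'' := hF ▸ hm'
  obtain ⟨b', c, g, hbc, hbg, hcg, rfl, rfl⟩ :=
    exists_Lmin_of_comp_eq hla' h1 (hx.trans h3.symm)
  have hcb := mem_Lmin_symm hbc
  obtain ⟨e1, e2, -, e4⟩ := mem_Lmin.1 hbc
  have hsum : n = (Λ.d lam' ⊔ Λ.d mu) + Λ.d g := by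
    rw [← hsn, ← hx, ← Λ.comp_assoc _ _ _ e1 hbg, Λ.d_comp _ _ (by rw [Λ.s_comp _ _ e1, hbg]), e4]
  rcases (hsum ▸ le_self_add : Λ.d lam' ⊔ Λ.d mu ≤ n).lt_or_eq with hlt | heq
  · refine Or.inr ⟨Λ.comp lam c, ?_, Λ.comp mu' b', ?_, g, ?_, ?_, ?_, ?_, ?_⟩
    · exact memF (comp_mem_PiSet hl hm hl''.1 hd hs hcb)
        (by rwa [d_comp_of_mem_Lmin hd hs hcb, sup_comm])
    · exact memF (comp_mem_PiSet hm''.1 hl''.1 hm hd'.symm (hma'.trans hla'.symm) hbc)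
        (by rwa [d_comp_of_mem_Lmin hd'.symm (hma'.trans hla'.symm) hbc])
    · rw [d_comp_of_mem_Lmin hd hs hcb, d_comp_of_mem_Lmin hd'.symm (hma'.trans hla'.symm) hbc,
        sup_comm]
    · rw [Λ.s_comp _ _ (hs.trans e2), hcg]
    · rw [Λ.s_comp _ _ ((hma'.trans hla'.symm).trans e1), hbg]
    · rwa [Λ.comp_assoc _ _ _ ((hma'.trans hla'.symm).trans e1) hbg]
    · rw [Λ.comp_assoc _ _ _ (hs.trans e2) hcg]
  · rw [heq] at hsum
    have hg : Λ.d g = 0 := left_eq_add.1 hsum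
    rw [comp_vertex hcg hg]
    exact Or.inl (base hlF hmF hl' hcb)

lemma finite_PiSet (hΛ : Λ.FinitelyAligned) (hE : E.Finite) : (Λ.PiSet E).Finite := by
  obtain ⟨N, hN⟩ := exists_d_le_of_mem_PiSet hE
  have hdeg : ∀ n : Fin k → ℕ, {x | x ∈ Λ.PiSet E ∧ Λ.d x = n}.Finite := by
    intro n
    induction n using WellFoundedLT.induction with
    | ind n ih =>
      have hF : {x | x ∈ Λ.PiSet E ∧ Λ.d x < n}.Finite := by
        refine ((Set.finite_Iio n).biUnion fun m hm => ih m hm).subset ?_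
        rintro x ⟨hx, hlt⟩
        exact Set.mem_biUnion (show Λ.d x ∈ Set.Iio n from hlt) ⟨hx, rfl⟩
      have hB := finite_basePaths hΛ hE hF
      exact (hB.union (finite_initialReplacements hF hB)).subset
        fun x hx => PiSet_degree_subset n rfl x hx.1 hx.2
  refine ((Set.finite_Iic N).biUnion fun m _ => hdeg m).subset fun x hx => ?_
  exact Set.mem_biUnion (show Λ.d x ∈ Set.Iic N from hN x hx) ⟨hx, rfl⟩

end PiSet

end KGraph

/-- If each product of two elements of a family `q` is a sum of values of `q` at common upper
bounds, then `1 - ∏ (1 - q)` decomposes as the sum of the differences between each `q a` and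
the join of the `q b` with `b` above `a`. -/
lemma Finset.sum_mul_prod_one_sub {ι R α : Type*} [CommRing R] [LinearOrder α] [DecidableEq ι]
    (F : Finset ι) (q : ι → R) (lt : ι → ι → Prop) [∀ a, DecidablePred (lt a)] (deg : ι → α)
    (hdeg : ∀ a b, lt a b → deg a < deg b) (hq : ∀ a ∈ F, q a * q a = q a)
    (hmul : ∀ a ∈ F, ∀ b ∈ F, ∃ M ⊆ F, q a * q b = ∑ x ∈ M, q x ∧
      ∀ x ∈ M, (x = a ∨ lt a x) ∧ (x = b ∨ lt b x)) :
    ∑ a ∈ F, q a * ∏ b ∈ F with lt a b, (1 - q b) = 1 - ∏ b ∈ F, (1 - q b) := by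
  suffices h : ∀ U : Finset ι, U ⊆ F → (∀ a ∈ U, ∀ b ∈ F, lt a b → b ∈ U) →
      ∑ a ∈ U, q a * ∏ b ∈ F with lt a b, (1 - q b) = 1 - ∏ b ∈ U, (1 - q b) from
    h F subset_rfl fun _ _ b hb _ => hb
  intro U
  induction U using Finset.induction_on_min_value deg with
  | empty => simp
  | insert a U haU hmin ih =>
    intro hUF hup
    have haF : a ∈ F := hUF (Finset.mem_insert_self a U)
    have hUF' : U ⊆ F := (Finset.subset_insert a U).trans hUF
    have hup' : ∀ x ∈ U, ∀ b ∈ F, lt x b → b ∈ U := by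
      intro x hx b hb hxb
      rcases Finset.mem_insert.1 (hup x (Finset.mem_insert_of_mem hx) b hb hxb) with rfl | h
      · exact absurd (hdeg x b hxb) (hmin x hx).not_gt
      · exact h
    set P := ∏ b ∈ F with lt a b, (1 - q b) with hP
    have hkill : ∀ x ∈ F, lt a x → q x * P = 0 := by
      intro x hx hax
      rw [hP, ← Finset.mul_prod_erase _ _ (Finset.mem_filter.2 ⟨hx, hax⟩), ← mul_assoc,
        mul_sub, hq x hx, mul_one, sub_self, zero_mul]
    have hortho : ∀ b ∈ U, q a * P * (1 - q b) = q a * P := by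
      intro b hb
      obtain ⟨M, hMF, hM, hbd⟩ := hmul a haF b (hUF' hb)
      have : q a * q b * P = 0 := by
        rw [hM, Finset.sum_mul]
        refine Finset.sum_eq_zero fun x hx => hkill x (hMF hx) ?_
        rcases (hbd x hx).1 with rfl | h
        · rcases (hbd x hx).2 with rfl | h
          · exact absurd hb haU
          · exact absurd (hdeg _ _ h) (hmin b hb).not_gt
        · exact h
      linear_combination -this
    have habs : ∀ S ⊆ U, q a * P * ∏ b ∈ S, (1 - q b) = q a * P := by
      intro S hS
      induction S using Finset.induction_on with
      | empty => simp
      | insert b S hb ihS =>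
        rw [Finset.prod_insert hb, ← mul_assoc, hortho b (hS (Finset.mem_insert_self b S)),
          ihS ((Finset.subset_insert b S).trans hS)]
    have hsub : F.filter (lt a) ⊆ U := by
      intro b hb
      obtain ⟨hbF, hab⟩ := Finset.mem_filter.1 hb
      rcases Finset.mem_insert.1 (hup a (Finset.mem_insert_self a U) b hbF hab) with rfl | h
      · exact absurd (hdeg _ _ hab) (lt_irrefl _)
      · exact h
    have hfull : q a * P = q a * ∏ b ∈ U, (1 - q b) := by
      rw [← habs _ (Finset.sdiff_subset (t := F.filter (lt a))), ← Finset.prod_sdiff hsub, ← hP]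
      ring
    rw [Finset.sum_insert haU, Finset.prod_insert haU, ih hUF' hup', hfull]
    ring

namespace KGraph

variable {k : ℕ} {Λ : KGraph k}

section Family

variable {A : Type*} [Ring A] [StarRing A] {t : Λ.Path → A}

namespace TCKFamily

lemma mul_eq (ht : Λ.TCKFamily t) {lam mu : Λ.Path} (h : Λ.s lam = Λ.r mu) :
    t lam * t mu = t (Λ.comp lam mu) := ht.2.2.1 lam mu h

lemma star_vertex (ht : Λ.TCKFamily t) {v : Λ.Path} (hv : Λ.d v = 0) : star (t v) = t v :=
  (ht.1 v hv).1

lemma mul_source (ht : Λ.TCKFamily t) (lam : Λ.Path) : t lam * t (Λ.s lam) = t lam := by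
  rw [ht.mul_eq (Λ.r_s lam).symm, Λ.comp_source]

lemma source_mul_star (ht : Λ.TCKFamily t) (lam : Λ.Path) :
    t (Λ.s lam) * star (t lam) = star (t lam) := by
  rw [← ht.star_vertex (Λ.d_s lam), ← star_mul, ht.mul_source]

lemma star_mul_range (ht : Λ.TCKFamily t) (lam : Λ.Path) :
    star (t lam) * t (Λ.r lam) = star (t lam) := by
  rw [← ht.star_vertex (Λ.d_r lam), ← star_mul, ht.mul_eq (Λ.s_r lam), Λ.range_comp]

lemma star_mul_self (ht : Λ.TCKFamily t) (lam : Λ.Path) :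
    star (t lam) * t lam = t (Λ.s lam) := by
  have : Λ.Lmin lam lam = {(Λ.s lam, Λ.s lam)} := by
    ext ⟨a, b⟩
    rw [mem_Lmin, Set.mem_singleton_iff, sup_idem, Prod.mk.injEq]
    constructor
    · rintro ⟨h1, h2, h3, h4⟩
      have ha : Λ.d a = 0 := by
        rw [Λ.d_comp _ _ h1] at h4
        exact add_eq_left.1 h4
      have hb : b = a := ((comp_inj h1 h2 h3 rfl).2).symm
      have : a = Λ.s lam := by rw [h1, r_eq_self ha]
      exact ⟨this, hb.trans this⟩
    · rintro ⟨rfl, rfl⟩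
      exact ⟨(Λ.r_s lam).symm, (Λ.r_s lam).symm, rfl, by rw [Λ.comp_source]⟩
  rw [ht.2.2.2, this, finsum_mem_singleton, ht.star_vertex (Λ.d_s lam), (ht.1 _ (Λ.d_s lam)).2]

/-- The product of two range projections is the sum of the range projections of the minimal
common extensions. -/
lemma range_mul_range (ht : Λ.TCKFamily t) (hΛ : Λ.FinitelyAligned) (mu nu : Λ.Path) :
    (t mu * star (t mu)) * (t nu * star (t nu)) =
      ∑ x ∈ (hΛ mu nu).toFinset, t x * star (t x) := by
  have h1 : (t mu * star (t mu)) * (t nu * star (t nu)) =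
      t mu * (star (t mu) * t nu) * star (t nu) := by simp only [mul_assoc]
  rw [h1, ht.2.2.2, ← finsum_mem_eq_finite_toFinset_sum,
    finsum_mem_eq_finite_toFinset_sum _ (finite_Lmin hΛ mu nu), Finset.mul_sum, Finset.sum_mul,
    ← finsum_mem_eq_finite_toFinset_sum _ (finite_Lmin hΛ mu nu)]
  refine finsum_mem_eq_of_bijOn _ (bijOn_Lmin mu nu) ?_
  rintro ⟨a, b⟩ hab
  obtain ⟨h1, h2, h3, -⟩ := mem_Lmin.1 hab
  simp only
  nth_rewrite 2 [h3]
  rw [← ht.mul_eq h1, ← ht.mul_eq h2, star_mul]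
  simp only [mul_assoc]

lemma range_commute (ht : Λ.TCKFamily t) (hΛ : Λ.FinitelyAligned) (mu nu : Λ.Path) :
    (t mu * star (t mu)) * (t nu * star (t nu)) =
      (t nu * star (t nu)) * (t mu * star (t mu)) := by
  rw [ht.range_mul_range hΛ, ht.range_mul_range hΛ]
  congr 1
  ext x
  simp [MCE_comm mu nu]

lemma range_idem (ht : Λ.TCKFamily t) (mu : Λ.Path) :
    (t mu * star (t mu)) * (t mu * star (t mu)) = t mu * star (t mu) := by
  rw [mul_assoc, ← mul_assoc (star _), ht.star_mul_self, ht.source_mul_star]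

lemma semiconjBy (ht : Λ.TCKFamily t) {nu rho : Λ.Path} (h : Λ.s nu = Λ.r rho) :
    t nu * (t (Λ.s nu) - t rho * star (t rho)) =
      (1 - t (Λ.comp nu rho) * star (t (Λ.comp nu rho))) * t nu := by
  have e : star (t rho) * star (t nu) * t nu = star (t rho) := by
    rw [mul_assoc, ht.star_mul_self, h, ht.star_mul_range]
  rw [mul_sub, sub_mul, one_mul, ht.mul_source, ← ht.mul_eq h, star_mul, mul_assoc (t nu * t rho),
    e, mul_assoc]

lemma mul_list_prod (ht : Λ.TCKFamily t) (nu : Λ.Path) (L : List Λ.Path)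
    (hL : ∀ rho ∈ L, Λ.s nu = Λ.r rho) :
    t nu * (L.map fun rho => t (Λ.s nu) - t rho * star (t rho)).prod =
      (L.map fun rho => 1 - t (Λ.comp nu rho) * star (t (Λ.comp nu rho))).prod * t nu := by
  induction L with
  | nil => simp
  | cons rho L ih =>
    rw [List.map_cons, List.map_cons, List.prod_cons, List.prod_cons, ← mul_assoc,
      ht.semiconjBy (hL rho List.mem_cons_self), mul_assoc,
      ih fun x hx => hL x (List.mem_cons_of_mem _ hx), mul_assoc]

end TCKFamily

variable (Λ) in
/-- `nu` is a proper initial segment of `rho`. -/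
def ProperPrefix (nu rho : Λ.Path) : Prop :=
  ∃ a, Λ.s nu = Λ.r a ∧ ¬ Λ.IsVertex a ∧ Λ.comp nu a = rho

lemma ProperPrefix.sum_d_lt {nu rho : Λ.Path} (h : Λ.ProperPrefix nu rho) :
    ∑ i, Λ.d nu i < ∑ i, Λ.d rho i := by
  obtain ⟨a, h1, h2, rfl⟩ := h
  rw [Λ.d_comp _ _ h1]
  simp only [Pi.add_apply, Finset.sum_add_distrib, lt_add_iff_pos_right]
  obtain ⟨i, hi⟩ := Function.ne_iff.1 h2
  exact Finset.sum_pos' (fun _ _ => Nat.zero_le _) ⟨i, Finset.mem_univ i, Nat.pos_of_ne_zero hi⟩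

lemma eq_or_properPrefix {nu a x : Λ.Path} (h : Λ.s nu = Λ.r a) (hx : Λ.comp nu a = x) :
    x = nu ∨ Λ.ProperPrefix nu x := by
  by_cases ha : Λ.IsVertex a
  · exact Or.inl (hx ▸ comp_vertex h ha)
  · exact Or.inr ⟨a, h, ha, hx⟩

/-- The paths `nu` with `lam nu ∈ ΠE`. -/
def PiTails (E : Set Λ.Path) (lam : Λ.Path) : Set Λ.Path :=
  {nu | Λ.s lam = Λ.r nu ∧ Λ.comp lam nu ∈ Λ.PiSet E}

lemma finite_PiTails (hΛ : Λ.FinitelyAligned) {E : Set Λ.Path} (hE : E.Finite)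
    (lam : Λ.Path) : (PiTails E lam).Finite := by
  refine Set.Finite.of_finite_image ((finite_PiSet hΛ hE).subset ?_) (f := Λ.comp lam) ?_
  · rintro _ ⟨nu, hnu, rfl⟩
    exact hnu.2
  · intro a ha b hb hab
    exact (comp_inj ha.1 hb.1 hab rfl).2

lemma MCE_subset_PiTails {E : Set Λ.Path} {lam mu nu : Λ.Path} (hmu : mu ∈ PiTails E lam)
    (hnu : nu ∈ PiTails E lam) : Λ.MCE mu nu ⊆ PiTails E lam := by
  intro x hx
  obtain ⟨hd, ⟨a, h1, rfl⟩, b, h2, h3⟩ := mem_MCE.1 hx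
  refine ⟨by rw [Λ.r_comp _ _ h1, hmu.1], ?_⟩
  have sm := Λ.s_comp _ _ hmu.1
  have sn := Λ.s_comp _ _ hnu.1
  rw [← Λ.comp_assoc _ _ _ hmu.1 h1]
  refine comp_mem_PiSet (b := b) hmu.2 hmu.2 hnu.2 rfl rfl
    (mem_Lmin.2 ⟨sm.trans h1, sn.trans h2, ?_, ?_⟩)
  · rw [Λ.comp_assoc _ _ _ hmu.1 h1, Λ.comp_assoc _ _ _ hnu.1 h2, h3]
  · rw [Λ.comp_assoc _ _ _ hmu.1 h1, Λ.d_comp _ _ (hmu.1.trans (Λ.r_comp _ _ h1).symm), hd,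
      Λ.d_comp _ _ hmu.1, Λ.d_comp _ _ hnu.1]
    funext i
    exact (max_add_add_left _ _ _).symm

/-- The ring generated by the range projections. -/
abbrev rangeRing (t : Λ.Path → A) : Subring A :=
  Subring.closure (Set.range fun x => t x * star (t x))

/-- A range projection, as an element of the ring they generate. -/
def rangeProj (t : Λ.Path → A) (x : Λ.Path) : rangeRing t :=
  ⟨t x * star (t x), Subring.subset_closure ⟨x, rfl⟩⟩

/-- The range projections of a family generate a commutative ring. -/
abbrev TCKFamily.commRing (ht : Λ.TCKFamily t) (hΛ : Λ.FinitelyAligned) :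
    CommRing (rangeRing t) :=
  { (inferInstance : Ring (rangeRing t)) with
    mul_comm := (Subring.isMulCommutative_closure (by
      rintro _ ⟨x, rfl⟩ _ ⟨y, rfl⟩
      exact ht.range_commute hΛ x y)).is_comm.comm }

lemma TCKFamily.conj_listProd (ht : Λ.TCKFamily t) (hΛ : Λ.FinitelyAligned) (nu : Λ.Path)
    {D : Set Λ.Path} (hD : D.Finite) (hr : ∀ rho ∈ D, Λ.s nu = Λ.r rho) :
    letI := ht.commRing hΛ
    t nu * listProd D (fun rho => t (Λ.s nu) - t rho * star (t rho)) * star (t nu) =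
      (rangeRing t).subtype
        (rangeProj t nu * ∏ rho ∈ hD.toFinset, (1 - rangeProj t (Λ.comp nu rho))) := by
  let _ := ht.commRing hΛ
  rw [listProd, dif_pos hD, ht.mul_list_prod nu _ (by simpa using hr), mul_comm (rangeProj t nu),
    map_mul, ← Finset.prod_map_toList, map_list_prod, List.map_map, mul_assoc]
  rfl

lemma TCKFamily.sum_conj_listProd (ht : Λ.TCKFamily t) (hΛ : Λ.FinitelyAligned)
    {E : Set Λ.Path} (hE : E.Finite) {lam : Λ.Path} (hlam : lam ∈ Λ.PiSet E) :
    ∑ nu ∈ (finite_PiTails hΛ hE lam).toFinset, t nu * listProd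
        {a | Λ.s nu = Λ.r a ∧ ¬ Λ.IsVertex a ∧ Λ.comp (Λ.comp lam nu) a ∈ Λ.PiSet E}
        (fun a => t (Λ.s nu) - t a * star (t a)) * star (t nu) = t (Λ.s lam) := by
  let _ := ht.commRing hΛ
  set F := (finite_PiTails hΛ hE lam).toFinset
  have memF : ∀ {x}, x ∈ F ↔ x ∈ PiTails E lam := Set.Finite.mem_toFinset _
  have hv : Λ.s lam ∈ F :=
    memF.2 ⟨(Λ.r_s lam).symm, by rwa [Λ.comp_source]⟩
  have hterm : ∀ nu ∈ F, t nu * listProd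
        {a | Λ.s nu = Λ.r a ∧ ¬ Λ.IsVertex a ∧ Λ.comp (Λ.comp lam nu) a ∈ Λ.PiSet E}
        (fun a => t (Λ.s nu) - t a * star (t a)) * star (t nu) =
      (rangeRing t).subtype
        (rangeProj t nu * ∏ b ∈ F with Λ.ProperPrefix nu b, (1 - rangeProj t b)) := by
    intro nu hnu
    have hn := memF.1 hnu
    have hs := Λ.s_comp _ _ hn.1
    have hD : {a | Λ.s nu = Λ.r a ∧ ¬ Λ.IsVertex a ∧
        Λ.comp (Λ.comp lam nu) a ∈ Λ.PiSet E}.Finite :=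
      (finite_PiTails hΛ hE (Λ.comp lam nu)).subset fun a ha => ⟨hs.trans ha.1, ha.2.2⟩
    rw [ht.conj_listProd hΛ nu hD fun a ha => ha.1]
    congr 2
    refine Finset.prod_bij (fun a _ => Λ.comp nu a) ?_ ?_ ?_ fun _ _ => rfl
    · intro a ha
      obtain ⟨h1, h2, h3⟩ := hD.mem_toFinset.1 ha
      refine Finset.mem_filter.2 ⟨memF.2 ⟨by rw [Λ.r_comp _ _ h1, hn.1], ?_⟩, a, h1, h2, rfl⟩
      rwa [← Λ.comp_assoc _ _ _ hn.1 h1]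
    · intro a ha b hb hab
      exact (comp_inj (hD.mem_toFinset.1 ha).1 (hD.mem_toFinset.1 hb).1 hab rfl).2
    · intro b hb
      obtain ⟨hbF, a, h1, h2, rfl⟩ := Finset.mem_filter.1 hb
      refine ⟨a, hD.mem_toFinset.2 ⟨h1, h2, ?_⟩, rfl⟩
      rw [Λ.comp_assoc _ _ _ hn.1 h1]
      exact (memF.1 hbF).2
  have hidem : ∀ a, rangeProj t a * rangeProj t a = rangeProj t a :=
    fun a => Subtype.ext (ht.range_idem a)
  have hsum := Finset.sum_mul_prod_one_sub F (rangeProj t) Λ.ProperPrefix (fun x => ∑ i, Λ.d x i)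
    (fun _ _ h => h.sum_d_lt) (fun a _ => hidem a) (by
      intro a ha b hb
      refine ⟨(hΛ a b).toFinset, ?_, ?_, ?_⟩
      · intro x hx
        exact memF.2 (MCE_subset_PiTails (memF.1 ha) (memF.1 hb) ((hΛ a b).mem_toFinset.1 hx))
      · apply (rangeRing t).subtype_injective
        rw [map_mul, map_sum]
        exact ht.range_mul_range hΛ a b
      · intro x hx
        obtain ⟨-, ⟨c, h1, h2⟩, e, h3, h4⟩ := mem_MCE.1 ((hΛ a b).mem_toFinset.1 hx)
        exact ⟨eq_or_properPrefix h1 h2, eq_or_properPrefix h3 h4⟩)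
  have hone : ∏ b ∈ F, (1 - rangeProj t b) = 1 - rangeProj t (Λ.s lam) := by
    have habs : ∀ b ∈ F, rangeProj t (Λ.s lam) * rangeProj t b = rangeProj t b := by
      intro b hb
      apply Subtype.ext
      change (t (Λ.s lam) * star (t (Λ.s lam))) * (t b * star (t b)) = t b * star (t b)
      rw [ht.star_vertex (Λ.d_s lam), (ht.1 _ (Λ.d_s lam)).2, (memF.1 hb).1, ← mul_assoc,
        ht.mul_eq (Λ.s_r b), Λ.range_comp]
    have hstep : ∀ G ⊆ F, (1 - rangeProj t (Λ.s lam)) * ∏ b ∈ G, (1 - rangeProj t b) =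
        1 - rangeProj t (Λ.s lam) := by
      intro G hG
      induction G using Finset.induction_on with
      | empty => simp
      | insert b G hb ih =>
        rw [Finset.prod_insert hb, mul_left_comm, ih ((Finset.subset_insert b G).trans hG)]
        linear_combination habs b (hG (Finset.mem_insert_self b G))
    rw [← Finset.mul_prod_erase F _ hv]
    exact hstep _ (Finset.erase_subset _ _)
  rw [Finset.sum_congr rfl hterm, ← map_sum, hsum, hone, sub_sub_cancel]
  change t (Λ.s lam) * star (t (Λ.s lam)) = _
  rw [ht.star_vertex (Λ.d_s lam), (ht.1 _ (Λ.d_s lam)).2]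

end Family

end KGraph

/-- (3.3) of the paper: for `(λ,μ) ∈ ΠE ×_{d,s} ΠE`,
`t_λ t_μ* = Σ_{ν : λν ∈ ΠE} Θ(t)^{ΠE}_{λν, μν}`. -/
theorem statement19 {k : ℕ} (Λ : KGraph k) (hΛ : Λ.FinitelyAligned)
    (E : Set Λ.Path) (hEfin : E.Finite)
    {A : Type*} [NormedRing A] [StarRing A] [CStarRing A] [NormedAlgebra ℂ A]
    [CompleteSpace A] [StarModule ℂ A]
    (t : Λ.Path → A) (ht : Λ.TCKFamily t)
    (lam mu : Λ.Path)
    (hlam : lam ∈ Λ.PiSet E) (hmu : mu ∈ Λ.PiSet E)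
    (hd : Λ.d lam = Λ.d mu) (hs : Λ.s lam = Λ.s mu) :
    t lam * star (t mu) =
      ∑ᶠ nu ∈ {nu : Λ.Path | Λ.s lam = Λ.r nu ∧ Λ.comp lam nu ∈ Λ.PiSet E},
        Λ.Theta t E (Λ.comp lam nu) (Λ.comp mu nu) := by
  have hfin := KGraph.finite_PiTails hΛ hEfin lam
  have key := ht.sum_conj_listProd hΛ hEfin hlam
  change _ = ∑ᶠ nu ∈ KGraph.PiTails E lam, _
  rw [finsum_mem_eq_finite_toFinset_sum _ hfin, ← ht.mul_source lam, ← key, Finset.mul_sum,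
    Finset.sum_mul]
  refine Finset.sum_congr rfl fun nu hnu => ?_
  have hn := (hfin.mem_toFinset.1 hnu).1
  rw [KGraph.Theta, Λ.s_comp _ _ hn, ← ht.mul_eq hn, ← ht.mul_eq (hs.symm.trans hn), star_mul]
  simp only [mul_assoc]
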